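/- arXiv:2302.08049 — 3 statements merged into one kernel-verified Lean document; each statement's English description precedes it below -/
import Mathlib

section
/- Let H ∈ ℝ^{d×d} be symmetric and let a, b ∈ ℝ. Define the symmetric block matrix B = [[(1+a²) I_d, (1−a²) I_d − bH], [(1−a²) I_d − bH, (1+a²) I_d]] ∈ ℝ^{2d×2d}. Then the spectrum of B equals {2 − bλ : λ an eigenvalue of H} ∪ {2a² + bλ : λ an eigenvalue of H}. Moreover, if b ≥ 0, m I_d ⪯ H ⪯ L I_d with m ≤ L, and bL ≤ 2, then the operator norm satisfies ‖B‖_op ≤ max{2a² + Lb, 2 − bm}. -/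
noncomputable section
open Matrix

/-- The determinant of a block matrix `[[P, Q], [Q, P]]` factors, even when `P` and `Q` do not
commute. -/
theorem Matrix.det_fromBlocks_swap_symm {n R : Type*} [Fintype n] [DecidableEq n] [CommRing R]
    (P Q : Matrix n n R) :
    (fromBlocks P Q Q P).det = (P + Q).det * (P - Q).det := by
  have key : fromBlocks 1 1 0 1 * fromBlocks P Q Q P * fromBlocks 1 (-1) 0 1 =
      fromBlocks (P + Q) 0 Q (P - Q) := by
    simp only [fromBlocks_multiply, fromBlocks_inj, one_mul, mul_one, zero_mul, mul_zero, mul_neg,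
      zero_add, add_zero, true_and]
    exact ⟨by abel, by abel⟩
  have hdet := congrArg det key
  rwa [det_mul, det_mul, det_fromBlocks_zero₂₁, det_fromBlocks_zero₂₁, det_fromBlocks_zero₁₂,
    det_one, one_mul, one_mul, mul_one] at hdet

theorem Matrix.spectrum_fromBlocks_swap_symm {n R : Type*} [Fintype n] [DecidableEq n]
    [CommRing R] (P Q : Matrix n n R) :
    spectrum R (fromBlocks P Q Q P) = spectrum R (P + Q) ∪ spectrum R (P - Q) := by
  ext r
  have hblocks : algebraMap R (Matrix (n ⊕ n) (n ⊕ n) R) r - fromBlocks P Q Q P =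
      fromBlocks (algebraMap R _ r - P) (-Q) (-Q) (algebraMap R _ r - P) := by
    simp only [Algebra.algebraMap_eq_smul_one, ← fromBlocks_one, fromBlocks_smul, smul_zero,
      sub_eq_add_neg, fromBlocks_neg, fromBlocks_add, zero_add]
  rw [Set.mem_union, spectrum.mem_iff, spectrum.mem_iff, spectrum.mem_iff, hblocks,
    isUnit_iff_isUnit_det, isUnit_iff_isUnit_det, isUnit_iff_isUnit_det,
    det_fromBlocks_swap_symm, IsUnit.mul_iff, ← not_and_or, sub_neg_eq_add, sub_sub_eq_add_sub,
    ← sub_eq_add_neg, sub_sub, add_sub_right_comm]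

theorem Matrix.IsHermitian.spectrum_const_add_smul {n 𝕜 : Type*} [Fintype n] [DecidableEq n]
    [RCLike 𝕜] {A : Matrix n n 𝕜} (hA : A.IsHermitian) (r c : ℝ) :
    spectrum ℝ (r • (1 : Matrix n n 𝕜) + c • A) = (fun x => r + c * x) '' spectrum ℝ A := by
  have hA' : IsSelfAdjoint A := hA
  rw [← cfc_map_spectrum (fun x : ℝ => r + c * x) A, cfc_const_add r (fun x => c * x) A,
    cfc_const_mul_id c A, Algebra.algebraMap_eq_smul_one]

open scoped Matrix.Norms.L2Operator in
theorem Matrix.IsHermitian.norm_toEuclideanCLM_le {n 𝕜 : Type*} [Fintype n] [DecidableEq n]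
    [RCLike 𝕜] {A : Matrix n n 𝕜} (hA : A.IsHermitian) {C : ℝ} (hC : 0 ≤ C)
    (h : ∀ x ∈ spectrum ℝ A, |x| ≤ C) :
    ‖toEuclideanCLM (𝕜 := 𝕜) (n := n) A‖ ≤ C := by
  rw [l2_opNorm_toEuclideanCLM, hA.spectral_theorem, Unitary.conjStarAlgAut_apply,
    ← Unitary.coe_star, CStarRing.norm_mul_coe_unitary, CStarRing.norm_coe_unitary_mul,
    l2_opNorm_diagonal, pi_norm_le_iff_of_nonneg hC]
  intro i
  simpa using h _ (hA.eigenvalues_mem_spectrum_real i)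

/-- **Lemma (spectrum and operator norm of the block matrix `B`).**
For symmetric `H` and reals `a, b`, the spectrum of
`B = [[(1+a²)I, (1−a²)I − bH], [(1−a²)I − bH, (1+a²)I]]` is
`{2 − bλ : λ ∈ spec H} ∪ {2a² + bλ : λ ∈ spec H}`; moreover if `b ≥ 0`,
`m I ⪯ H ⪯ L I` with `m ≤ L` and `bL ≤ 2`, then `‖B‖_op ≤ max (2a² + Lb) (2 − bm)`. -/
theorem block_matrix_spectrum_and_opNorm (d : ℕ) (H : Matrix (Fin d) (Fin d) ℝ) (a b : ℝ)
    (hH : H.IsSymm) :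
    spectrum ℝ (Matrix.fromBlocks ((1 + a^2) • (1 : Matrix (Fin d) (Fin d) ℝ))
        ((1 - a^2) • (1 : Matrix (Fin d) (Fin d) ℝ) - b • H)
        ((1 - a^2) • (1 : Matrix (Fin d) (Fin d) ℝ) - b • H)
        ((1 + a^2) • (1 : Matrix (Fin d) (Fin d) ℝ)))
      = ((fun lam => 2 - b * lam) '' spectrum ℝ H)
          ∪ ((fun lam => 2 * a^2 + b * lam) '' spectrum ℝ H) ∧
    (∀ m L : ℝ, 0 ≤ b → m ≤ L → b * L ≤ 2 →
      (∀ lam ∈ spectrum ℝ H, lam ∈ Set.Icc m L) →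
      ‖Matrix.toEuclideanCLM (𝕜 := ℝ) (n := Fin d ⊕ Fin d)
          (Matrix.fromBlocks ((1 + a^2) • (1 : Matrix (Fin d) (Fin d) ℝ))
            ((1 - a^2) • (1 : Matrix (Fin d) (Fin d) ℝ) - b • H)
            ((1 - a^2) • (1 : Matrix (Fin d) (Fin d) ℝ) - b • H)
            ((1 + a^2) • (1 : Matrix (Fin d) (Fin d) ℝ)))‖
        ≤ max (2 * a^2 + L * b) (2 - b * m)) := by
  have hH' : H.IsHermitian := by rwa [IsHermitian, conjTranspose_eq_transpose_of_trivial]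
  set P : Matrix (Fin d) (Fin d) ℝ := (1 + a ^ 2) • 1 with hP
  set Q : Matrix (Fin d) (Fin d) ℝ := (1 - a ^ 2) • 1 - b • H with hQ
  have hadd : P + Q = (2 : ℝ) • 1 + (-b) • H := by rw [hP, hQ]; module
  have hsub : P - Q = (2 * a ^ 2) • 1 + b • H := by rw [hP, hQ]; module
  have hspec : spectrum ℝ (fromBlocks P Q Q P) = ((fun lam => 2 - b * lam) '' spectrum ℝ H)
      ∪ ((fun lam => 2 * a ^ 2 + b * lam) '' spectrum ℝ H) := by
    rw [spectrum_fromBlocks_swap_symm, hadd, hsub, hH'.spectrum_const_add_smul,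
      hH'.spectrum_const_add_smul]
    simp only [neg_mul, ← sub_eq_add_neg]
  refine ⟨hspec, fun m L hb hmL hbL hlam => ?_⟩
  have hPs : P.IsHermitian := by simp [hP, IsHermitian]
  have hQs : Q.IsHermitian := by simp [hQ, IsHermitian, hH.eq]
  have hbm : b * m ≤ b * L := mul_le_mul_of_nonneg_left hmL hb
  refine (hPs.fromBlocks hQs.eq hPs).norm_toEuclideanCLM_le
    (le_max_of_le_right (by linarith)) fun x hx => ?_
  rw [hspec] at hx
  rcases hx with ⟨lam, hl, rfl⟩ | ⟨lam, hl, rfl⟩ <;>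
  · obtain ⟨h₁, h₂⟩ := hlam lam hl
    have hm := mul_le_mul_of_nonneg_left h₁ hb
    have hL := mul_le_mul_of_nonneg_left h₂ hb
    have hmax₁ := le_max_left (2 * a ^ 2 + L * b) (2 - b * m)
    have hmax₂ := le_max_right (2 * a ^ 2 + L * b) (2 - b * m)
    exact abs_le.mpr ⟨by nlinarith [sq_nonneg a], by nlinarith [sq_nonneg a]⟩

end
end

section
/- Let μ and ν be probability measures on ℝ^n with μ ≪ ν and R₂(μ‖ν) := log ∫ (dμ/dν)² dν < ∞. Suppose there exist R₀ ≥ 0, C ≥ 1 and c > 0 such that ν{x : ‖x‖ ≥ R₀ + η} ≤ C exp(−c η²) for all η ≥ 0. Then μ{x : ‖x‖ ≥ R₀ + √(R₂(μ‖ν)/c) + η} ≤ 2C exp(−c η²/2) for all η ≥ 0. -/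
noncomputable section
open MeasureTheory

/-- Cauchy–Schwarz for a change of measure: `μ A ^ 2 ≤ (∫ (dμ/dν)² dν) * ν A`. -/
theorem measure_sq_le_lintegral_rnDeriv_sq_mul {α : Type*} [MeasurableSpace α]
    (μ ν : Measure α) [SigmaFinite μ] [SigmaFinite ν] (hac : μ ≪ ν) (A : Set α) :
    μ A ^ 2 ≤ (∫⁻ x, (μ.rnDeriv ν x) ^ 2 ∂ν) * ν A := by
  have h := ENNReal.lintegral_mul_le_Lp_mul_Lq (ν.restrict A) Real.HolderConjugate.two_two
    (μ.measurable_rnDeriv ν).aemeasurable (g := 1) aemeasurable_const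
  simp only [mul_one, Pi.one_apply, lintegral_const,
    Measure.restrict_apply MeasurableSet.univ, Set.univ_inter,
    Measure.setLIntegral_rnDeriv hac, ENNReal.rpow_ofNat] at h
  have hsq (x : ENNReal) : (x ^ (1 / 2 : ℝ)) ^ 2 = x := by
    rw [← ENNReal.rpow_natCast, ← ENNReal.rpow_mul]; norm_num
  calc μ A ^ 2 ≤ ((∫⁻ x in A, (μ.rnDeriv ν x) ^ 2 ∂ν) ^ (1 / 2 : ℝ) * ν A ^ (1 / 2 : ℝ)) ^ 2 := by
        gcongr
        simpa using h
    _ = (∫⁻ x in A, (μ.rnDeriv ν x) ^ 2 ∂ν) * ν A := by rw [mul_pow, hsq, hsq]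
    _ ≤ _ := by gcongr; exact Measure.restrict_le_self

theorem le_exp_mul_sqrt_log_div_sq {c : ℝ} (hc : 0 < c) (I : ℝ) :
    I ≤ Real.exp (c * Real.sqrt (Real.log I / c) ^ 2) := by
  rcases le_total I 1 with h | h
  · exact h.trans (Real.one_le_exp (by positivity))
  · rw [Real.sq_sqrt (div_nonneg (Real.log_nonneg h) hc.le), mul_div_cancel₀ _ hc.ne',
      Real.exp_log (by linarith)]

/-- **Lemma (sub-Gaussian tail transfer under a Rényi-2 bound).**
If `μ ≪ ν` are probability measures on `ℝ^n` with `R₂(μ‖ν) = log ∫ (dμ/dν)² dν < ∞`, and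
`ν{‖·‖ ≥ R₀ + η} ≤ C e^{−cη²}` for all `η ≥ 0` (with `C ≥ 1`, `c > 0`), then
`μ{‖·‖ ≥ R₀ + √(R₂(μ‖ν)/c) + η} ≤ 2C e^{−cη²/2}` for all `η ≥ 0`. -/
theorem subgaussian_tail_transfer {n : ℕ} (μ ν : Measure (EuclideanSpace ℝ (Fin n)))
    [IsProbabilityMeasure μ] [IsProbabilityMeasure ν] (hac : μ ≪ ν)
    (hfin : (∫⁻ x, (μ.rnDeriv ν x)^2 ∂ν) < ⊤)
    (R₀ C c : ℝ) (hR₀ : 0 ≤ R₀) (hC : 1 ≤ C) (hc : 0 < c)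
    (htail : ∀ η : ℝ, 0 ≤ η →
      ν {x | R₀ + η ≤ ‖x‖} ≤ ENNReal.ofReal (C * Real.exp (-(c * η^2)))) :
    ∀ η : ℝ, 0 ≤ η →
      μ {x | R₀ + Real.sqrt (Real.log (∫⁻ x, (μ.rnDeriv ν x)^2 ∂ν).toReal / c) + η ≤ ‖x‖}
        ≤ ENNReal.ofReal (2 * C * Real.exp (-(c * η^2 / 2))) := by
  intro η hη
  set I := ∫⁻ x, (μ.rnDeriv ν x)^2 ∂ν
  set s := Real.sqrt (Real.log I.toReal / c)
  have hs : 0 ≤ s := Real.sqrt_nonneg _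
  have hIs : I.toReal ≤ Real.exp (c * s ^ 2) :=
    le_exp_mul_sqrt_log_div_sq hc _
  have hν := htail (s + η) (by positivity)
  rw [← add_assoc] at hν
  refine (ENNReal.pow_right_strictMono two_ne_zero).le_iff_le.1 ?_
  calc μ {x | R₀ + s + η ≤ ‖x‖} ^ 2
      ≤ I * ν {x | R₀ + s + η ≤ ‖x‖} := measure_sq_le_lintegral_rnDeriv_sq_mul μ ν hac _
    _ ≤ ENNReal.ofReal (Real.exp (c * s ^ 2)) *
          ENNReal.ofReal (C * Real.exp (-(c * (s + η) ^ 2))) := by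
        gcongr
        exact (ENNReal.le_ofReal_iff_toReal_le hfin.ne (Real.exp_nonneg _)).2 hIs
    _ = ENNReal.ofReal (C * Real.exp (c * s ^ 2 + -(c * (s + η) ^ 2))) := by
        rw [← ENNReal.ofReal_mul (Real.exp_nonneg _), Real.exp_add]
        ring_nf
    _ ≤ ENNReal.ofReal ((2 * C) ^ 2 * Real.exp (-(c * η ^ 2))) := by
        refine ENNReal.ofReal_le_ofReal ?_
        have : 0 ≤ c * (s * η) := by positivity
        gcongr <;> nlinarith
    _ = ENNReal.ofReal (2 * C * Real.exp (-(c * η ^ 2 / 2))) ^ 2 := by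
        rw [← ENNReal.ofReal_pow (by positivity), mul_pow _ (Real.exp _), ← Real.exp_nat_mul]
        congr 3
        push_cast
        ring

end
end

section
/- Let U : ℝ^d → ℝ be measurable with ∫ e^{−U} < ∞, and let π be the probability measure with density proportional to e^{−U}. For β ≥ 0 and S ≥ 0 define the modified potential U^{(a)}(x) = U(x) + (β/2)(‖x‖ − S)₊² and let π^{(a)} be the probability measure with density proportional to e^{−U^{(a)}}. If π(B(0,S)) ≥ 1/2, where B(0,S) is the closed Euclidean ball of radius S centered at 0, then for all η ≥ 0: π^{(a)}{x : ‖x‖ ≥ S + η} ≤ 2 exp(−β η²/2). -/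
noncomputable section
open MeasureTheory Real

abbrev E (d : ℕ) : Type := EuclideanSpace ℝ (Fin d)

/-- the probability measure on `ℝ^d` with density proportional to `exp (-U)`. -/
def gibbs (d : ℕ) (U : E d → ℝ) : Measure (E d) :=
  ((volume.withDensity fun x => ENNReal.ofReal (exp (-U x))) Set.univ)⁻¹ •
    (volume.withDensity fun x => ENNReal.ofReal (exp (-U x)))

/-- **Lemma (sub-Gaussian tail of the modified target).**
If `π ∝ e^{−U}` has `π(B(0,S)) ≥ 1/2`, then the modified target
`π^{(a)} ∝ exp(−U − (β/2)(‖·‖−S)₊²)` satisfies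
`π^{(a)}{‖x‖ ≥ S + η} ≤ 2 exp(−βη²/2)` for all `η ≥ 0`. -/
theorem modified_target_tail (d : ℕ) (U : E d → ℝ) (hU : Measurable U) (β S : ℝ)
    (hβ : 0 ≤ β) (hS : 0 ≤ S)
    (hZ0 : (volume.withDensity fun x : E d => ENNReal.ofReal (exp (-U x))) Set.univ ≠ 0)
    (hZfin : (volume.withDensity fun x : E d => ENNReal.ofReal (exp (-U x))) Set.univ ≠ ⊤)
    (hball : ENNReal.ofReal (1/2) ≤ gibbs d U (Metric.closedBall 0 S)) :
    ∀ η : ℝ, 0 ≤ η →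
      gibbs d (fun x => U x + β/2 * max (‖x‖ - S) 0 ^ 2) {x : E d | S + η ≤ ‖x‖}
        ≤ ENNReal.ofReal (2 * exp (-(β * η^2 / 2))) := by
  intro η hη
  set f : E d → ENNReal := fun x => ENNReal.ofReal (exp (-U x)) with hf
  set g : E d → ENNReal :=
    fun x => ENNReal.ofReal (exp (-(U x + β/2 * max (‖x‖ - S) 0 ^ 2))) with hg
  set c : ENNReal := ENNReal.ofReal (exp (-(β * η^2 / 2))) with hc
  have hfm : Measurable f := by fun_prop
  have hB : MeasurableSet (Metric.closedBall (0 : E d) S) := Metric.isClosed_closedBall.measurableSet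
  have hT : MeasurableSet {x : E d | S + η ≤ ‖x‖} :=
    (isClosed_le continuous_const continuous_norm).measurableSet
  have hball_eq : volume.withDensity g (Metric.closedBall 0 S)
      = volume.withDensity f (Metric.closedBall 0 S) := by
    rw [withDensity_apply _ hB, withDensity_apply _ hB]
    refine setLIntegral_congr_fun hB fun x hx => ?_
    have hx' : ‖x‖ - S ≤ 0 := by simpa using hx
    simp [hf, hg, max_eq_right hx']
  have htail : volume.withDensity g {x : E d | S + η ≤ ‖x‖}
      ≤ c * volume.withDensity f {x : E d | S + η ≤ ‖x‖} := by
    rw [withDensity_apply _ hT, withDensity_apply _ hT, ← lintegral_const_mul _ hfm]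
    refine setLIntegral_mono (hfm.const_mul c) fun x hx => ?_
    have hx' : η ≤ max (‖x‖ - S) 0 := le_max_of_le_left (by linarith [show S + η ≤ ‖x‖ from hx])
    rw [hc, hf, hg, ← ENNReal.ofReal_mul (exp_pos _).le, ← exp_add]
    refine ENNReal.ofReal_le_ofReal (exp_le_exp.2 ?_)
    have := mul_le_mul_of_nonneg_left (pow_le_pow_left₀ hη hx' 2) hβ
    linarith
  have hhalf : volume.withDensity f Set.univ
      ≤ 2 * volume.withDensity f (Metric.closedBall 0 S) := by
    have h : ENNReal.ofReal (1/2)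
        ≤ volume.withDensity f (Metric.closedBall 0 S) / volume.withDensity f Set.univ := by
      rwa [gibbs, Measure.smul_apply, smul_eq_mul, mul_comm, ← div_eq_mul_inv] at hball
    rw [ENNReal.le_div_iff_mul_le (Or.inl hZ0) (Or.inl hZfin)] at h
    calc volume.withDensity f Set.univ
        = 2 * (ENNReal.ofReal (1/2) * volume.withDensity f Set.univ) := by
          have h2 : (2 : ENNReal) * ENNReal.ofReal (1/2) = 1 := by
            rw [← ENNReal.ofReal_ofNat 2, ← ENNReal.ofReal_mul (by norm_num)]
            norm_num
          rw [← mul_assoc, h2, one_mul]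
      _ ≤ _ := by gcongr
  rw [gibbs, Measure.smul_apply, smul_eq_mul, mul_comm, ← div_eq_mul_inv,
    ENNReal.ofReal_mul (by norm_num), ENNReal.ofReal_ofNat]
  refine ENNReal.div_le_of_le_mul ?_
  calc volume.withDensity g {x : E d | S + η ≤ ‖x‖}
      ≤ c * volume.withDensity f Set.univ := htail.trans (by gcongr; exact Set.subset_univ _)
    _ ≤ c * (2 * volume.withDensity g (Metric.closedBall 0 S)) := by rw [hball_eq]; gcongr
    _ = 2 * c * volume.withDensity g (Metric.closedBall 0 S) := by ring
    _ ≤ 2 * c * volume.withDensity g Set.univ := by gcongr; exact Set.subset_univ _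

end
end
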